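/- arXiv:1109.4699 — 7 statements merged into one kernel-verified Lean document; each statement's English description precedes it below -/
import Mathlib

section
/- The group G acts transitively on the Lorentz cone L: for all x, y ∈ L there exists (a, A) ∈ G such that a • A x = y. -/
open scoped RealInnerProductSpace

/-- The symmetric bilinear form `Ψ((λ,w),(μ,u)) = λμ − ⟪w,u⟫` on `ℝ × W`. -/
noncomputable def Psi {m : ℕ} (x y : ℝ × EuclideanSpace ℝ (Fin m)) : ℝ :=
  x.1 * y.1 - ⟪x.2, y.2⟫

/-- The Lorentz cone `L = {(λ,w) : λ > 0, λ² > ‖w‖²}`. -/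
def LorentzCone (m : ℕ) : Set (ℝ × EuclideanSpace ℝ (Fin m)) :=
  {x | 0 < x.1 ∧ ‖x.2‖ ^ 2 < x.1 ^ 2}

/-- The pair `(a, A)` belongs to the group `G = ℝ₊₊ × SO⁺(Ψ)`: `a > 0`, `A` preserves `Ψ`,
`det A = 1`, and the first component of `A(1,0)` is positive. -/
noncomputable def MemG {m : ℕ} (a : ℝ)
    (A : (ℝ × EuclideanSpace ℝ (Fin m)) ≃ₗ[ℝ] (ℝ × EuclideanSpace ℝ (Fin m))) : Prop :=
  0 < a ∧ (∀ x y, Psi (A x) (A y) = Psi x y) ∧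
    LinearMap.det (A : (ℝ × EuclideanSpace ℝ (Fin m)) →ₗ[ℝ] (ℝ × EuclideanSpace ℝ (Fin m))) = 1 ∧
    0 < (A (1, 0)).1

section Psi

variable {m : ℕ}

theorem Psi_comm (x y : ℝ × EuclideanSpace ℝ (Fin m)) : Psi x y = Psi y x := by
  simp only [Psi, real_inner_comm, mul_comm]

theorem Psi_add_left (x y z : ℝ × EuclideanSpace ℝ (Fin m)) :
    Psi (x + y) z = Psi x z + Psi y z := by
  simp only [Psi, Prod.fst_add, Prod.snd_add, inner_add_left]
  ring

theorem Psi_smul_left (c : ℝ) (x y : ℝ × EuclideanSpace ℝ (Fin m)) :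
    Psi (c • x) y = c * Psi x y := by
  simp only [Psi, Prod.smul_fst, Prod.smul_snd, smul_eq_mul, real_inner_smul_left]
  ring

theorem Psi_sub_left (x y z : ℝ × EuclideanSpace ℝ (Fin m)) :
    Psi (x - y) z = Psi x z - Psi y z := by
  simp only [Psi, Prod.fst_sub, Prod.snd_sub, inner_sub_left]
  ring

theorem Psi_add_right (x y z : ℝ × EuclideanSpace ℝ (Fin m)) :
    Psi x (y + z) = Psi x y + Psi x z := by
  simp only [Psi_comm x, Psi_add_left]

theorem Psi_smul_right (c : ℝ) (x y : ℝ × EuclideanSpace ℝ (Fin m)) :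
    Psi x (c • y) = c * Psi x y := by
  simp only [Psi_comm x, Psi_smul_left]

theorem Psi_sub_right (x y z : ℝ × EuclideanSpace ℝ (Fin m)) :
    Psi x (y - z) = Psi x y - Psi x z := by
  simp only [Psi_comm x, Psi_sub_left]

theorem mem_LorentzCone_iff_Psi {x : ℝ × EuclideanSpace ℝ (Fin m)} :
    x ∈ LorentzCone m ↔ 0 < x.1 ∧ 0 < Psi x x := by
  simp only [LorentzCone, Set.mem_ofPred_eq, Psi, real_inner_self_eq_norm_sq, sub_pos, sq]

theorem mem_LorentzCone_iff_norm_lt {x : ℝ × EuclideanSpace ℝ (Fin m)} :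
    x ∈ LorentzCone m ↔ ‖x.2‖ < x.1 := by
  constructor
  · rintro ⟨h, h'⟩
    exact lt_of_pow_lt_pow_left₀ 2 h.le h'
  · intro h
    exact ⟨(norm_nonneg _).trans_lt h, pow_lt_pow_left₀ h (norm_nonneg _) two_ne_zero⟩

theorem add_mem_LorentzCone {x y : ℝ × EuclideanSpace ℝ (Fin m)}
    (hx : x ∈ LorentzCone m) (hy : y ∈ LorentzCone m) : x + y ∈ LorentzCone m := by
  rw [mem_LorentzCone_iff_norm_lt] at *
  exact (norm_add_le _ _).trans_lt (add_lt_add hx hy)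

theorem smul_mem_LorentzCone {c : ℝ} (hc : 0 < c) {x : ℝ × EuclideanSpace ℝ (Fin m)}
    (hx : x ∈ LorentzCone m) : c • x ∈ LorentzCone m := by
  rw [mem_LorentzCone_iff_Psi] at *
  rw [Psi_smul_left, Psi_smul_right]
  exact ⟨mul_pos hc hx.1, mul_pos hc (mul_pos hc hx.2)⟩

/-- The linear form `x ↦ 2 Ψ(x, v) / Ψ(v, v)`. -/
noncomputable def PsiCoroot (v : ℝ × EuclideanSpace ℝ (Fin m)) :
    Module.Dual ℝ (ℝ × EuclideanSpace ℝ (Fin m)) where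
  toFun x := 2 * Psi x v / Psi v v
  map_add' x y := by rw [Psi_add_left]; ring
  map_smul' c x := by rw [Psi_smul_left, RingHom.id_apply, smul_eq_mul]; ring

theorem PsiCoroot_apply (v x : ℝ × EuclideanSpace ℝ (Fin m)) :
    PsiCoroot v x = 2 * Psi x v / Psi v v := rfl

theorem PsiCoroot_self {v : ℝ × EuclideanSpace ℝ (Fin m)} (hv : Psi v v ≠ 0) :
    PsiCoroot v v = 2 := by
  rw [PsiCoroot_apply, mul_div_cancel_right₀ _ hv]

/-- The `Ψ`-orthogonal reflection in the hyperplane orthogonal to `v`. -/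
noncomputable def PsiReflection {v : ℝ × EuclideanSpace ℝ (Fin m)} (hv : Psi v v ≠ 0) :
    (ℝ × EuclideanSpace ℝ (Fin m)) ≃ₗ[ℝ] (ℝ × EuclideanSpace ℝ (Fin m)) :=
  Module.reflection (PsiCoroot_self hv)

theorem PsiReflection_apply {v : ℝ × EuclideanSpace ℝ (Fin m)} (hv : Psi v v ≠ 0)
    (x : ℝ × EuclideanSpace ℝ (Fin m)) :
    PsiReflection hv x = x - (2 * Psi x v / Psi v v) • v :=
  Module.reflection_apply _ _

theorem PsiReflection_self {v : ℝ × EuclideanSpace ℝ (Fin m)} (hv : Psi v v ≠ 0) :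
    PsiReflection hv v = -v :=
  Module.reflection_apply_self _

theorem Psi_PsiReflection {v : ℝ × EuclideanSpace ℝ (Fin m)} (hv : Psi v v ≠ 0)
    (x y : ℝ × EuclideanSpace ℝ (Fin m)) :
    Psi (PsiReflection hv x) (PsiReflection hv y) = Psi x y := by
  simp only [PsiReflection_apply, Psi_sub_left, Psi_sub_right, Psi_smul_left, Psi_smul_right,
    Psi_comm v y]
  field_simp
  ring

theorem det_PsiReflection {v : ℝ × EuclideanSpace ℝ (Fin m)} (hv : Psi v v ≠ 0) :
    LinearMap.det (PsiReflection hv : (ℝ × EuclideanSpace ℝ (Fin m)) →ₗ[ℝ] _) = -1 := by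
  have h : (PsiReflection hv : (ℝ × EuclideanSpace ℝ (Fin m)) →ₗ[ℝ] _) =
      LinearMap.transvection (-PsiCoroot v) v := by
    refine LinearMap.ext fun x => ?_
    rw [LinearMap.transvection.apply, LinearMap.neg_apply, neg_smul, ← sub_eq_add_neg]
    exact PsiReflection_apply hv x
  rw [h, LinearMap.transvection.det, LinearMap.neg_apply, PsiCoroot_self hv]
  norm_num

/-- A reflection in a timelike vector exchanges the cone and its negative. -/
theorem neg_PsiReflection_mem_LorentzCone {v x : ℝ × EuclideanSpace ℝ (Fin m)}
    (hv : v ∈ LorentzCone m) (hv' : Psi v v ≠ 0) (hx : x ∈ LorentzCone m) :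
    -PsiReflection hv' x ∈ LorentzCone m := by
  rw [mem_LorentzCone_iff_Psi]
  constructor
  · have hvv := (mem_LorentzCone_iff_Psi.1 hv).2
    have hin : ⟪x.2, v.2⟫ ≤ x.1 * ‖v.2‖ :=
      (real_inner_le_norm _ _).trans <| mul_le_mul_of_nonneg_right
        (mem_LorentzCone_iff_norm_lt.1 hx).le (norm_nonneg _)
    have hlt : 0 < v.1 - ‖v.2‖ := sub_pos.2 (mem_LorentzCone_iff_norm_lt.1 hv)
    have key : x.1 * Psi v v < 2 * Psi x v * v.1 := by
      simp only [Psi, real_inner_self_eq_norm_sq]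
      nlinarith [mul_le_mul_of_nonneg_left hin hv.1.le, mul_pos hx.1 (pow_pos hlt 2)]
    have : x.1 < 2 * Psi x v / Psi v v * v.1 := by
      rw [div_mul_eq_mul_div]
      exact (lt_div_iff₀ hvv).2 key
    simpa [PsiReflection_apply] using this
  · rw [← neg_one_smul ℝ, Psi_smul_left, Psi_smul_right, Psi_PsiReflection]
    simpa using (mem_LorentzCone_iff_Psi.1 hx).2

/-- If `Ψ(x, x) = Ψ(y, y)` then the reflection along `x + y` maps `x` to `-y`. -/
theorem PsiReflection_add_apply_left {x y : ℝ × EuclideanSpace ℝ (Fin m)}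
    (hxy : Psi x x = Psi y y) (h : Psi (x + y) (x + y) ≠ 0) :
    PsiReflection h x = -y := by
  have : 2 * Psi x (x + y) = Psi (x + y) (x + y) := by
    simp only [Psi_add_left, Psi_add_right, Psi_comm y x, ← hxy]
    ring
  rw [PsiReflection_apply, this, div_self h, one_smul]
  abel

/-- The group `SO⁺(Ψ)` acts transitively on each level set of `Ψ` in the cone. -/
theorem exists_memG_one_apply_eq {x y : ℝ × EuclideanSpace ℝ (Fin m)}
    (hx : x ∈ LorentzCone m) (hy : y ∈ LorentzCone m) (hxy : Psi x x = Psi y y) :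
    ∃ A : (ℝ × EuclideanSpace ℝ (Fin m)) ≃ₗ[ℝ] (ℝ × EuclideanSpace ℝ (Fin m)),
      MemG 1 A ∧ A x = y := by
  have hv := add_mem_LorentzCone hx hy
  have hv' := (mem_LorentzCone_iff_Psi.1 hv).2.ne'
  have hy' := (mem_LorentzCone_iff_Psi.1 hy).2.ne'
  refine ⟨(PsiReflection hv').trans (PsiReflection hy'), ⟨one_pos, fun u w => ?_, ?_, ?_⟩, ?_⟩
  · simp only [LinearEquiv.trans_apply, Psi_PsiReflection]
  · rw [LinearEquiv.coe_trans, LinearMap.det_comp, det_PsiReflection, det_PsiReflection]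
    norm_num
  · have he : ((1, 0) : ℝ × EuclideanSpace ℝ (Fin m)) ∈ LorentzCone m := by
      simp [LorentzCone]
    have h := neg_PsiReflection_mem_LorentzCone hy hy'
      (neg_PsiReflection_mem_LorentzCone hv hv' he)
    rw [map_neg, neg_neg] at h
    exact h.1
  · rw [LinearEquiv.trans_apply, PsiReflection_add_apply_left hxy, map_neg, PsiReflection_self,
      neg_neg]

end Psi

theorem G_transitive_on_lorentzCone (m : ℕ) (hm : 1 ≤ m)
    (x y : ℝ × EuclideanSpace ℝ (Fin m))
    (hx : x ∈ LorentzCone m) (hy : y ∈ LorentzCone m) :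
    ∃ (a : ℝ) (A : (ℝ × EuclideanSpace ℝ (Fin m)) ≃ₗ[ℝ] (ℝ × EuclideanSpace ℝ (Fin m))),
      MemG a A ∧ a • A x = y := by
  have hx' := (mem_LorentzCone_iff_Psi.1 hx).2
  have hy' := (mem_LorentzCone_iff_Psi.1 hy).2
  set a := √(Psi y y / Psi x x)
  have ha : 0 < a := Real.sqrt_pos.2 (div_pos hy' hx')
  have ha2 : a * a = Psi y y / Psi x x := Real.mul_self_sqrt (div_pos hy' hx').le
  have hnorm : Psi x x = Psi (a⁻¹ • y) (a⁻¹ • y) := by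
    rw [Psi_smul_left, Psi_smul_right, ← mul_assoc, ← mul_inv, ha2]
    field_simp
  obtain ⟨A, hA, hAx⟩ :=
    exists_memG_one_apply_eq hx (smul_mem_LorentzCone (inv_pos.2 ha) hy) hnorm
  exact ⟨a, A, ⟨ha, hA.2⟩, by rw [hAx, smul_inv_smul₀ ha.ne']⟩
end

section
/- Let A be a linear automorphism of V = ℝ × W with Ψ(Ax, Ay) = Ψ(x, y) for all x, y, det A = 1, and the first component of A(1,0) positive. Then A(L_0) ⊆ L_0 if and only if A maps the subspace ℝ × W_0 into itself and maps the subspace {0} × W_0^⊥ into itself (so that A is block diagonal with respect to the decomposition (ℝ × W_0) × W_0^⊥, the block A_0 on ℝ × W_0 preserving the restriction of Ψ and the block on W_0^⊥ preserving the restriction of the inner product). -/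
open scoped RealInnerProductSpace

/-- The maximal invariant statistic `π(σ₁,σ₂) = (ξ₁, ξ₂)`, the eigenvalues of `σ₂` with
respect to `σ₁`. -/
noncomputable def piStat {m : ℕ} (σ₁ σ₂ : ℝ × EuclideanSpace ℝ (Fin m)) : ℝ × ℝ :=
  ((Psi σ₁ σ₂ + Real.sqrt ((Psi σ₁ σ₂) ^ 2 - Psi σ₁ σ₁ * Psi σ₂ σ₂)) / Psi σ₁ σ₁,
   (Psi σ₁ σ₂ - Real.sqrt ((Psi σ₁ σ₂) ^ 2 - Psi σ₁ σ₁ * Psi σ₂ σ₂)) / Psi σ₁ σ₁)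


/-- The Lorentz subcone `L₀` generated by a subspace `W₀ ⊆ W`. -/
def LorentzSubcone (m : ℕ) (W₀ : Submodule ℝ (EuclideanSpace ℝ (Fin m))) :
    Set (ℝ × EuclideanSpace ℝ (Fin m)) :=
  {x | x ∈ LorentzCone m ∧ x.2 ∈ W₀}

section

variable {m : ℕ} {W₀ : Submodule ℝ (EuclideanSpace ℝ (Fin m))}
  {A : (ℝ × EuclideanSpace ℝ (Fin m)) ≃ₗ[ℝ] (ℝ × EuclideanSpace ℝ (Fin m))}

/-- If the `Psi`-product of a timelike vector with a vector of the Lorentz cone is positive, the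
timelike vector has positive first component. -/
lemma fst_pos_of_Psi_pos {x y : ℝ × EuclideanSpace ℝ (Fin m)} (hx : ‖x.2‖ ^ 2 < x.1 ^ 2)
    (hy : y ∈ LorentzCone m) (hxy : 0 < Psi x y) : 0 < x.1 := by
  by_contra! h
  obtain ⟨hy₁, hy₂⟩ := hy
  have hx' : ‖x.2‖ ≤ -x.1 :=
    le_of_lt (lt_of_pow_lt_pow_left₀ 2 (by linarith) (by rwa [neg_sq]))
  have hy' : ‖y.2‖ ≤ y.1 := le_of_lt (lt_of_pow_lt_pow_left₀ 2 hy₁.le hy₂)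
  have hmul := mul_le_mul hx' hy' (norm_nonneg _) (by linarith)
  have hcs := neg_le_of_abs_le (abs_real_inner_le_norm x.2 y.2)
  unfold Psi at hxy
  linarith

/-- An orthochronous Lorentz transformation maps the Lorentz cone into itself. -/
lemma map_mem_LorentzCone (hΨ : ∀ x y, Psi (A x) (A y) = Psi x y) (hpos : 0 < (A (1, 0)).1)
    {x : ℝ × EuclideanSpace ℝ (Fin m)} (hx : x ∈ LorentzCone m) : A x ∈ LorentzCone m := by
  have timelike : ∀ y ∈ LorentzCone m, ‖(A y).2‖ ^ 2 < (A y).1 ^ 2 := fun y hy => by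
    have h := hΨ y y
    simp only [Psi, real_inner_self_eq_norm_sq] at h
    linarith [hy.2]
  have he : ((1, 0) : ℝ × EuclideanSpace ℝ (Fin m)) ∈ LorentzCone m := by simp [LorentzCone]
  refine ⟨fst_pos_of_Psi_pos (timelike x hx) ⟨hpos, timelike _ he⟩ ?_, timelike x hx⟩
  rw [hΨ]
  simpa [Psi] using hx.1

/-- A linear map preserving the Lorentz subcone of `W₀` preserves its span `ℝ × W₀`. -/
lemma map_snd_mem_of_maps_subcone (h : ∀ x ∈ LorentzSubcone m W₀, A x ∈ LorentzSubcone m W₀)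
    {x : ℝ × EuclideanSpace ℝ (Fin m)} (hx : x.2 ∈ W₀) : (A x).2 ∈ W₀ := by
  have hn := norm_nonneg x.2
  have h₁ : (A (‖x.2‖ + 1, x.2)).2 ∈ W₀ :=
    (h (‖x.2‖ + 1, x.2) ⟨⟨by positivity, by dsimp only; nlinarith⟩, hx⟩).2
  have h₂ : (A (1, 0)).2 ∈ W₀ := (h _ ⟨by simp [LorentzCone], W₀.zero_mem⟩).2
  have hdecomp : x = (‖x.2‖ + 1, x.2) + (x.1 - (‖x.2‖ + 1)) • (1, 0) := by ext <;> simp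
  rw [hdecomp, map_add, map_smul]
  exact W₀.add_mem h₁ (W₀.smul_mem _ h₂)

/-- A `Psi`-isometry preserving `ℝ × W₀` preserves its `Psi`-orthogonal complement
`{0} × W₀ᗮ`. -/
lemma map_orthogonal_of_map_snd_mem (hΨ : ∀ x y, Psi (A x) (A y) = Psi x y)
    (h : ∀ x : ℝ × EuclideanSpace ℝ (Fin m), x.2 ∈ W₀ → (A x).2 ∈ W₀)
    {w : EuclideanSpace ℝ (Fin m)} (hw : w ∈ W₀ᗮ) :
    (A (0, w)).1 = 0 ∧ (A (0, w)).2 ∈ W₀ᗮ := by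
  let U := W₀.comap (LinearMap.snd ℝ ℝ (EuclideanSpace ℝ (Fin m)))
  have hU : U.map A.toLinearMap = U :=
    Submodule.eq_of_le_of_finrank_eq (Submodule.map_le_iff_le_comap.2 h) (A.finrank_map_eq U)
  have horth : ∀ y : ℝ × EuclideanSpace ℝ (Fin m), y.2 ∈ W₀ → Psi (A (0, w)) y = 0 := by
    intro y hy
    obtain ⟨u, hu, rfl⟩ : y ∈ U.map A.toLinearMap := hU.symm ▸ hy
    have hin : ⟪w, u.2⟫ = 0 := (W₀.mem_orthogonal' w).1 hw u.2 hu
    simpa [hin, Psi] using hΨ (0, w) u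
  refine ⟨by simpa [Psi] using horth (1, 0) W₀.zero_mem, ?_⟩
  exact (W₀.mem_orthogonal' _).2 fun v hv => by simpa [Psi] using horth (0, v) hv

end

theorem block_diagonal_iff_maps_subcone (m : ℕ) (hm : 1 ≤ m)
    (W₀ : Submodule ℝ (EuclideanSpace ℝ (Fin m))) (hW₀ : W₀ ≠ ⊥) (hW₀' : W₀ ≠ ⊤)
    (A : (ℝ × EuclideanSpace ℝ (Fin m)) ≃ₗ[ℝ] (ℝ × EuclideanSpace ℝ (Fin m)))
    (hΨ : ∀ x y, Psi (A x) (A y) = Psi x y)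
    (hdet : LinearMap.det
      (A : (ℝ × EuclideanSpace ℝ (Fin m)) →ₗ[ℝ] (ℝ × EuclideanSpace ℝ (Fin m))) = 1)
    (hpos : 0 < (A (1, 0)).1) :
    (∀ x ∈ LorentzSubcone m W₀, A x ∈ LorentzSubcone m W₀) ↔
      ((∀ x : ℝ × EuclideanSpace ℝ (Fin m), x.2 ∈ W₀ → (A x).2 ∈ W₀) ∧
       (∀ w ∈ W₀ᗮ, (A (0, w)).1 = 0 ∧ (A (0, w)).2 ∈ W₀ᗮ) ∧
       (∀ x y : ℝ × EuclideanSpace ℝ (Fin m), x.2 ∈ W₀ → y.2 ∈ W₀ →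
          Psi (A x) (A y) = Psi x y) ∧
       (∀ w ∈ W₀ᗮ, ∀ u ∈ W₀ᗮ, ⟪(A (0, w)).2, (A (0, u)).2⟫ = ⟪w, u⟫)) := by
  refine ⟨fun h => ?_, fun h x hx => ⟨map_mem_LorentzCone hΨ hpos hx.1, h.1 x hx.2⟩⟩
  have hsnd : ∀ x : ℝ × EuclideanSpace ℝ (Fin m), x.2 ∈ W₀ → (A x).2 ∈ W₀ :=
    fun x hx => map_snd_mem_of_maps_subcone h hx
  have horth : ∀ w ∈ W₀ᗮ, (A (0, w)).1 = 0 ∧ (A (0, w)).2 ∈ W₀ᗮ :=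
    fun w hw => map_orthogonal_of_map_snd_mem hΨ hsnd hw
  refine ⟨hsnd, horth, fun x y _ _ => hΨ x y, fun w hw u _ => ?_⟩
  simpa [Psi, (horth w hw).1] using hΨ (0, w) (0, u)
end

section
/- For each observation x ∈ L, the maximum likelihood estimator in the full Lorentz Wishart model is x itself: for every σ ∈ L, f_σ(x) ≤ f_x(x), where f_σ is the Lorentz Wishart density with shape parameter η. -/
open scoped RealInnerProductSpace Classical

/-- The normalizing constant `k(m,η) = 2 π^{(m−1)/2} Γ(η) Γ(η − (m−1)/2) η^{−2η}`. -/
noncomputable def kConst (m : ℕ) (η : ℝ) : ℝ :=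
  2 * Real.pi ^ (((m : ℝ) - 1) / 2) * Real.Gamma η * Real.Gamma (η - ((m : ℝ) - 1) / 2) *
    η ^ (-(2 * η))

/-- The Lorentz Wishart density `f_σ` with shape parameter `η` and scale parameter `σ ∈ L`,
with respect to Lebesgue measure on `ℝ × W`. -/

noncomputable def wishartDensity (m : ℕ) (η : ℝ) (σ : ℝ × EuclideanSpace ℝ (Fin m))
    (x : ℝ × EuclideanSpace ℝ (Fin m)) : ℝ :=
  if x ∈ LorentzCone m then
    (kConst m η)⁻¹ * (σ.1 ^ 2 - ‖σ.2‖ ^ 2) ^ (-η) *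
      (x.1 ^ 2 - ‖x.2‖ ^ 2) ^ (η - ((m : ℝ) + 1) / 2) *
      Real.exp (-2 * η * (σ.1 * x.1 - ⟪σ.2, x.2⟫) / (σ.1 ^ 2 - ‖σ.2‖ ^ 2))
  else 0

/-- Reversed Cauchy–Schwarz inequality on the Lorentz cone. -/
theorem sqrt_mul_sqrt_le_of_mem_LorentzCone {m : ℕ} {x y : ℝ × EuclideanSpace ℝ (Fin m)}
    (hx : x ∈ LorentzCone m) (hy : y ∈ LorentzCone m) :
    √(x.1 ^ 2 - ‖x.2‖ ^ 2) * √(y.1 ^ 2 - ‖y.2‖ ^ 2) ≤ x.1 * y.1 - ⟪x.2, y.2⟫ := by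
  obtain ⟨hx0, hx1⟩ := hx
  obtain ⟨hy0, hy1⟩ := hy
  have hxn : ‖x.2‖ < x.1 := lt_of_pow_lt_pow_left₀ 2 hx0.le hx1
  have hyn : ‖y.2‖ < y.1 := lt_of_pow_lt_pow_left₀ 2 hy0.le hy1
  have hnn : ‖x.2‖ * ‖y.2‖ ≤ x.1 * y.1 :=
    mul_le_mul hxn.le hyn.le (norm_nonneg _) hx0.le
  refine le_trans ?_ (sub_le_sub_left (real_inner_le_norm x.2 y.2) _)
  rw [← Real.sqrt_mul (sub_pos.2 hx1).le]
  refine Real.sqrt_le_iff.2 ⟨sub_nonneg.2 hnn, ?_⟩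
  nlinarith [sq_nonneg (x.1 * ‖y.2‖ - y.1 * ‖x.2‖)]

theorem rpow_neg_mul_exp_le {η A B P : ℝ} (hη : 0 ≤ η) (hA : 0 < A) (hB : 0 < B)
    (hP : √A * √B ≤ P) :
    A ^ (-η) * Real.exp (-2 * η * P / A) ≤ B ^ (-η) * Real.exp (-2 * η) := by
  rw [Real.rpow_def_of_pos hA, Real.rpow_def_of_pos hB, ← Real.exp_add, ← Real.exp_add,
    Real.exp_le_exp]
  have hsA : 0 < √A := Real.sqrt_pos.2 hA
  have hsB : 0 < √B := Real.sqrt_pos.2 hB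
  have hlog := Real.log_le_sub_one_of_pos (div_pos hsB hsA)
  rw [Real.log_div hsB.ne' hsA.ne', Real.log_sqrt hB.le, Real.log_sqrt hA.le] at hlog
  have hle : √B / √A ≤ P / A := by
    rw [div_le_div_iff₀ hsA hA]
    calc √B * A = √A * √B * √A := by nth_rewrite 1 [← Real.mul_self_sqrt hA.le]; ring
      _ ≤ P * √A := mul_le_mul_of_nonneg_right hP hsA.le
  have key : 0 ≤ η * (2 * (P / A) - 2 - (Real.log B - Real.log A)) :=
    mul_nonneg hη (by linarith)
  rw [mul_div_assoc]
  linarith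

theorem mle_full_model (m : ℕ) (hm : 1 ≤ m) (η : ℝ) (hη : ((m : ℝ) - 1) / 2 < η)
    (x : ℝ × EuclideanSpace ℝ (Fin m)) (hx : x ∈ LorentzCone m)
    (σ : ℝ × EuclideanSpace ℝ (Fin m)) (hσ : σ ∈ LorentzCone m) :
    wishartDensity m η σ x ≤ wishartDensity m η x x := by
  have hm' : (0 : ℝ) ≤ ((m : ℝ) - 1) / 2 := by
    have : (1 : ℝ) ≤ m := by exact_mod_cast hm
    linarith
  have hη0 : 0 < η := hm'.trans_lt hη
  have hA : 0 < σ.1 ^ 2 - ‖σ.2‖ ^ 2 := sub_pos.2 hσ.2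
  have hB : 0 < x.1 ^ 2 - ‖x.2‖ ^ 2 := sub_pos.2 hx.2
  have hk : 0 < kConst m η := by
    have := Real.Gamma_pos_of_pos hη0
    have := Real.Gamma_pos_of_pos (sub_pos.2 hη)
    have := Real.pi_pos
    unfold kConst
    positivity
  have key := rpow_neg_mul_exp_le hη0.le hA hB (sqrt_mul_sqrt_le_of_mem_LorentzCone hσ hx)
  have hself : -2 * η * (x.1 * x.1 - ⟪x.2, x.2⟫) / (x.1 ^ 2 - ‖x.2‖ ^ 2) = -2 * η := by
    rw [real_inner_self_eq_norm_sq, ← sq, mul_div_assoc, div_self hB.ne', mul_one]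
  simp only [wishartDensity, if_pos hx, hself]
  have hc : 0 ≤ (kConst m η)⁻¹ * (x.1 ^ 2 - ‖x.2‖ ^ 2) ^ (η - ((m : ℝ) + 1) / 2) := by
    positivity
  linarith [mul_le_mul_of_nonneg_left key hc]
end

section
/- For σ₁, σ₂ ∈ L, the numbers ξ₁ = (Ψ(σ₁,σ₂) + √(Ψ(σ₁,σ₂)² − Ψ(σ₁,σ₁)Ψ(σ₂,σ₂)))/Ψ(σ₁,σ₁) and ξ₂ = (Ψ(σ₁,σ₂) − √(Ψ(σ₁,σ₂)² − Ψ(σ₁,σ₁)Ψ(σ₂,σ₂)))/Ψ(σ₁,σ₁) are well defined (the expression under the square root is nonnegative), are both strictly positive, and are precisely the two roots of the characteristic polynomial p(ℓ) = Ψ(σ₂ − ℓ σ₁, σ₂ − ℓ σ₁) = Ψ(σ₁,σ₁) ℓ² − 2 Ψ(σ₁,σ₂) ℓ + Ψ(σ₂,σ₂) of σ₂ with respect to σ₁. -/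
open scoped RealInnerProductSpace

theorem Psi_self {m : ℕ} (x : ℝ × EuclideanSpace ℝ (Fin m)) :
    Psi x x = x.1 ^ 2 - ‖x.2‖ ^ 2 := by
  rw [Psi, real_inner_self_eq_norm_sq, sq x.1]

theorem Psi_self_pos {m : ℕ} {x : ℝ × EuclideanSpace ℝ (Fin m)} (hx : x ∈ LorentzCone m) :
    0 < Psi x x := by
  rw [Psi_self]
  exact sub_pos.mpr hx.2

theorem norm_snd_lt_fst {m : ℕ} {x : ℝ × EuclideanSpace ℝ (Fin m)} (hx : x ∈ LorentzCone m) :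
    ‖x.2‖ < x.1 :=
  lt_of_pow_lt_pow_left₀ 2 hx.1.le hx.2

theorem fst_mul_fst_sub_norm_mul_norm_le_Psi {m : ℕ} (x y : ℝ × EuclideanSpace ℝ (Fin m)) :
    x.1 * y.1 - ‖x.2‖ * ‖y.2‖ ≤ Psi x y :=
  sub_le_sub_left (real_inner_le_norm x.2 y.2) _

theorem fst_mul_fst_sub_norm_mul_norm_pos {m : ℕ} {x y : ℝ × EuclideanSpace ℝ (Fin m)}
    (hx : x ∈ LorentzCone m) (hy : y ∈ LorentzCone m) :
    0 < x.1 * y.1 - ‖x.2‖ * ‖y.2‖ :=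
  sub_pos.mpr <| mul_lt_mul'' (norm_snd_lt_fst hx) (norm_snd_lt_fst hy)
    (norm_nonneg _) (norm_nonneg _)

theorem Psi_pos {m : ℕ} {x y : ℝ × EuclideanSpace ℝ (Fin m)}
    (hx : x ∈ LorentzCone m) (hy : y ∈ LorentzCone m) : 0 < Psi x y :=
  (fst_mul_fst_sub_norm_mul_norm_pos hx hy).trans_le (fst_mul_fst_sub_norm_mul_norm_le_Psi x y)

/-- The reversed Cauchy–Schwarz inequality on the Lorentz cone. -/
theorem Psi_self_mul_Psi_self_le_sq {m : ℕ} {x y : ℝ × EuclideanSpace ℝ (Fin m)}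
    (hx : x ∈ LorentzCone m) (hy : y ∈ LorentzCone m) :
    Psi x x * Psi y y ≤ Psi x y ^ 2 :=
  calc Psi x x * Psi y y ≤ (x.1 * y.1 - ‖x.2‖ * ‖y.2‖) ^ 2 := by
        rw [Psi_self, Psi_self]
        linarith [sq_nonneg (x.1 * ‖y.2‖ - y.1 * ‖x.2‖)]
    _ ≤ Psi x y ^ 2 :=
        pow_le_pow_left₀ (fst_mul_fst_sub_norm_mul_norm_pos hx hy).le
          (fst_mul_fst_sub_norm_mul_norm_le_Psi x y) 2

theorem Psi_sub_smul_self {m : ℕ} (x y : ℝ × EuclideanSpace ℝ (Fin m)) (t : ℝ) :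
    Psi (y - t • x) (y - t • x) = Psi x x * t ^ 2 - 2 * Psi x y * t + Psi y y := by
  simp only [Psi, Prod.fst_sub, Prod.snd_sub, Prod.smul_fst, Prod.smul_snd, smul_eq_mul,
    inner_sub_left, inner_sub_right, real_inner_smul_left, real_inner_smul_right,
    real_inner_comm x.2 y.2]
  ring

theorem quadratic_eq_zero_iff_of_discrim_nonneg {a b c : ℝ} (ha : a ≠ 0)
    (hd : 0 ≤ b ^ 2 - a * c) (t : ℝ) :
    a * t ^ 2 - 2 * b * t + c = 0 ↔
      t = (b + √(b ^ 2 - a * c)) / a ∨ t = (b - √(b ^ 2 - a * c)) / a := by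
  have hs : (a * t - b) ^ 2 - √(b ^ 2 - a * c) ^ 2 = a * (a * t ^ 2 - 2 * b * t + c) := by
    rw [Real.sq_sqrt hd]
    ring
  rw [← mul_eq_zero_iff_left ha, ← hs, sub_eq_zero, sq_eq_sq_iff_eq_or_eq_neg,
    eq_div_iff ha, eq_div_iff ha, mul_comm t a, sub_eq_iff_eq_add', sub_eq_iff_eq_add',
    ← sub_eq_add_neg]

theorem piStat_eigenvalues (m : ℕ) (hm : 1 ≤ m)
    (σ₁ σ₂ : ℝ × EuclideanSpace ℝ (Fin m))
    (h₁ : σ₁ ∈ LorentzCone m) (h₂ : σ₂ ∈ LorentzCone m) :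
    0 ≤ (Psi σ₁ σ₂) ^ 2 - Psi σ₁ σ₁ * Psi σ₂ σ₂ ∧
    0 < (piStat σ₁ σ₂).1 ∧ 0 < (piStat σ₁ σ₂).2 ∧
    (∀ ℓ : ℝ, Psi (σ₂ - ℓ • σ₁) (σ₂ - ℓ • σ₁) =
      Psi σ₁ σ₁ * ℓ ^ 2 - 2 * Psi σ₁ σ₂ * ℓ + Psi σ₂ σ₂) ∧
    (∀ ℓ : ℝ, Psi σ₁ σ₁ * ℓ ^ 2 - 2 * Psi σ₁ σ₂ * ℓ + Psi σ₂ σ₂ = 0 ↔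
      ℓ = (piStat σ₁ σ₂).1 ∨ ℓ = (piStat σ₁ σ₂).2) := by
  have ha := Psi_self_pos h₁
  have hb := Psi_pos h₁ h₂
  have hd := sub_nonneg.mpr (Psi_self_mul_Psi_self_le_sq h₁ h₂)
  have hlt : √(Psi σ₁ σ₂ ^ 2 - Psi σ₁ σ₁ * Psi σ₂ σ₂) < Psi σ₁ σ₂ :=
    (Real.sqrt_lt' hb).mpr (sub_lt_self _ (mul_pos ha (Psi_self_pos h₂)))
  exact ⟨hd, div_pos (add_pos_of_pos_of_nonneg hb (Real.sqrt_nonneg _)) ha,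
    div_pos (sub_pos.mpr hlt) ha, Psi_sub_smul_self σ₁ σ₂,
    quadratic_eq_zero_iff_of_discrim_nonneg ha.ne' hd⟩
end

section
/- The map π : L × L → ℝ², π(σ₁,σ₂) = (ξ₁, ξ₂) with ξ_{1,2} = (Ψ(σ₁,σ₂) ± √(Ψ(σ₁,σ₂)² − Ψ(σ₁,σ₁)Ψ(σ₂,σ₂)))/Ψ(σ₁,σ₁), is invariant under the diagonal action of G: for every (a, A) ∈ G and σ₁, σ₂ ∈ L, π(a • A σ₁, a • A σ₂) = π(σ₁, σ₂). -/
open scoped RealInnerProductSpace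

theorem Psi_smul_smul {m : ℕ} (a : ℝ) (x y : ℝ × EuclideanSpace ℝ (Fin m)) :
    Psi (a • x) (a • y) = a ^ 2 * Psi x y := by
  simp only [Psi, Prod.smul_fst, Prod.smul_snd, smul_eq_mul, real_inner_smul_left,
    real_inner_smul_right]
  ring

theorem piStat_smul_smul {m : ℕ} {a : ℝ} (ha : a ≠ 0) (x y : ℝ × EuclideanSpace ℝ (Fin m)) :
    piStat (a • x) (a • y) = piStat x y := by
  have hsqrt : Real.sqrt ((a ^ 2 * Psi x y) ^ 2 - a ^ 2 * Psi x x * (a ^ 2 * Psi y y)) =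
      a ^ 2 * Real.sqrt ((Psi x y) ^ 2 - Psi x x * Psi y y) := by
    rw [show (a ^ 2 * Psi x y) ^ 2 - a ^ 2 * Psi x x * (a ^ 2 * Psi y y) =
      (a ^ 2) ^ 2 * ((Psi x y) ^ 2 - Psi x x * Psi y y) by ring,
      Real.sqrt_mul (sq_nonneg _), Real.sqrt_sq (sq_nonneg a)]
  have ha2 : a ^ 2 ≠ 0 := pow_ne_zero 2 ha
  simp only [piStat, Psi_smul_smul, hsqrt, ← mul_add, ← mul_sub, mul_div_mul_left _ _ ha2]

theorem piStat_invariant (m : ℕ) (hm : 1 ≤ m)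
    (a : ℝ) (A : (ℝ × EuclideanSpace ℝ (Fin m)) ≃ₗ[ℝ] (ℝ × EuclideanSpace ℝ (Fin m)))
    (hG : MemG a A)
    (σ₁ σ₂ : ℝ × EuclideanSpace ℝ (Fin m))
    (h₁ : σ₁ ∈ LorentzCone m) (h₂ : σ₂ ∈ LorentzCone m) :
    piStat (a • A σ₁) (a • A σ₂) = piStat σ₁ σ₂ := by
  obtain ⟨ha, hA, -, -⟩ := hG
  rw [piStat_smul_smul ha.ne']
  simp only [piStat, hA]
end

section
/- The map π(σ₁,σ₂) = (ξ₁, ξ₂), with ξ_{1,2} = (Ψ(σ₁,σ₂) ± √(Ψ(σ₁,σ₂)² − Ψ(σ₁,σ₁)Ψ(σ₂,σ₂)))/Ψ(σ₁,σ₁), attains every admissible value: for all real numbers r₁ ≥ r₂ > 0 there exist σ₁, σ₂ ∈ L with π(σ₁, σ₂) = (r₁, r₂). -/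
open scoped RealInnerProductSpace

theorem piStat_surjective (m : ℕ) (hm : 1 ≤ m)
    (r₁ r₂ : ℝ) (h₁₂ : r₂ ≤ r₁) (h₂ : 0 < r₂) :
    ∃ σ₁ σ₂ : ℝ × EuclideanSpace ℝ (Fin m),
      σ₁ ∈ LorentzCone m ∧ σ₂ ∈ LorentzCone m ∧ piStat σ₁ σ₂ = (r₁, r₂) := by
  let e : EuclideanSpace ℝ (Fin m) := EuclideanSpace.single ⟨0, hm⟩ 1
  have he : ‖((r₁ - r₂) / 2) • e‖ = (r₁ - r₂) / 2 := by
    rw [norm_smul, PiLp.norm_single, norm_one, mul_one, Real.norm_eq_abs,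
      abs_of_nonneg (by linarith)]
  refine ⟨(1, 0), ((r₁ + r₂) / 2, ((r₁ - r₂) / 2) • e), ?_, ?_, ?_⟩
  · simp [LorentzCone]
  · refine ⟨show 0 < (r₁ + r₂) / 2 by linarith, ?_⟩
    change ‖((r₁ - r₂) / 2) • e‖ ^ 2 < ((r₁ + r₂) / 2) ^ 2
    rw [he]
    nlinarith [mul_pos (h₂.trans_le h₁₂) h₂]
  · have hdisc : ((r₁ + r₂) / 2) ^ 2 - 1 * ((r₁ + r₂) / 2 * ((r₁ + r₂) / 2) -
        ((r₁ - r₂) / 2) ^ 2) = ((r₁ - r₂) / 2) ^ 2 := by ring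
    simp only [piStat, Psi, real_inner_self_eq_norm_sq, he, inner_zero_left, one_mul, mul_one,
      sub_zero, div_one] at hdisc ⊢
    rw [hdisc, Real.sqrt_sq (by linarith)]
    ext <;> simp only <;> ring
end

section
/- For two observations τ₁, τ₂ ∈ L, the maximum likelihood estimator of the common parameter in the model {f_σ ⊗ f_σ : σ ∈ L} is their average: for every σ ∈ L, f_σ(τ₁) · f_σ(τ₂) ≤ f_{(τ₁+τ₂)/2}(τ₁) · f_{(τ₁+τ₂)/2}(τ₂), where f_σ is the Lorentz Wishart density with shape parameter η. (Note (τ₁+τ₂)/2 ∈ L since L is a convex cone.) -/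
open scoped RealInnerProductSpace Classical

/-- The Lorentz cone is closed under taking midpoints. -/
lemma LorentzCone.midpoint_mem {m : ℕ} {x y : ℝ × EuclideanSpace ℝ (Fin m)}
    (hx : x ∈ LorentzCone m) (hy : y ∈ LorentzCone m) :
    (2:ℝ)⁻¹ • (x + y) ∈ LorentzCone m := by
  obtain ⟨hx₀, hx₁⟩ := hx
  obtain ⟨hy₀, hy₁⟩ := hy
  have hx₂ : ‖x.2‖ < x.1 := lt_of_pow_lt_pow_left₀ 2 hx₀.le hx₁
  have hy₂ : ‖y.2‖ < y.1 := lt_of_pow_lt_pow_left₀ 2 hy₀.le hy₁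
  have hfst : ((2:ℝ)⁻¹ • (x + y)).1 = 2⁻¹ * (x.1 + y.1) := rfl
  have hsnd : ‖((2:ℝ)⁻¹ • (x + y)).2‖ = 2⁻¹ * ‖x.2 + y.2‖ := by
    rw [Prod.smul_snd, Prod.snd_add, norm_smul]
    norm_num
  refine ⟨by rw [hfst]; positivity, ?_⟩
  rw [hfst, hsnd]
  have := norm_add_le x.2 y.2
  gcongr
  linarith

/-- The reverse Cauchy–Schwarz inequality on the Lorentz cone. -/
lemma LorentzCone.sqrt_mul_sqrt_le_Psi {m : ℕ} {x y : ℝ × EuclideanSpace ℝ (Fin m)}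
    (hx : x ∈ LorentzCone m) (hy : y ∈ LorentzCone m) :
    √(x.1 ^ 2 - ‖x.2‖ ^ 2) * √(y.1 ^ 2 - ‖y.2‖ ^ 2) ≤ Psi x y := by
  obtain ⟨hx₀, hx₁⟩ := hx
  obtain ⟨hy₀, hy₁⟩ := hy
  have hx₂ : ‖x.2‖ ≤ x.1 := (lt_of_pow_lt_pow_left₀ 2 hx₀.le hx₁).le
  have hy₂ : ‖y.2‖ ≤ y.1 := (lt_of_pow_lt_pow_left₀ 2 hy₀.le hy₁).le
  have hinner : ⟪x.2, y.2⟫ ≤ ‖x.2‖ * ‖y.2‖ := real_inner_le_norm _ _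
  have hnorm : ‖x.2‖ * ‖y.2‖ ≤ x.1 * y.1 := by gcongr
  rw [← Real.sqrt_mul (sub_nonneg.2 hx₁.le)]
  calc √((x.1 ^ 2 - ‖x.2‖ ^ 2) * (y.1 ^ 2 - ‖y.2‖ ^ 2))
      ≤ x.1 * y.1 - ‖x.2‖ * ‖y.2‖ := by
        refine Real.sqrt_le_iff.2 ⟨sub_nonneg.2 hnorm, ?_⟩
        nlinarith [sq_nonneg (x.1 * ‖y.2‖ - y.1 * ‖x.2‖)]
    _ ≤ Psi x y := by unfold Psi; linarith

/-- The joint density of two observations depends on the scale parameter only through an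
exponential factor involving their average. -/
lemma wishartDensity_mul_wishartDensity {m : ℕ} (η : ℝ)
    {σ x y : ℝ × EuclideanSpace ℝ (Fin m)} (hσ : σ ∈ LorentzCone m)
    (hx : x ∈ LorentzCone m) (hy : y ∈ LorentzCone m) :
    wishartDensity m η σ x * wishartDensity m η σ y =
      ((kConst m η)⁻¹ ^ 2 * (x.1 ^ 2 - ‖x.2‖ ^ 2) ^ (η - ((m : ℝ) + 1) / 2) *
        (y.1 ^ 2 - ‖y.2‖ ^ 2) ^ (η - ((m : ℝ) + 1) / 2)) *
      Real.exp (-2 * η * (Real.log (σ.1 ^ 2 - ‖σ.2‖ ^ 2) +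
        2 * Psi σ ((2:ℝ)⁻¹ • (x + y)) / (σ.1 ^ 2 - ‖σ.2‖ ^ 2))) := by
  have hd : 0 < σ.1 ^ 2 - ‖σ.2‖ ^ 2 := sub_pos.2 hσ.2
  have hPsi : 2 * Psi σ ((2:ℝ)⁻¹ • (x + y)) =
      (σ.1 * x.1 - ⟪σ.2, x.2⟫) + (σ.1 * y.1 - ⟪σ.2, y.2⟫) := by
    simp only [Psi, Prod.smul_fst, Prod.smul_snd, Prod.fst_add, Prod.snd_add, inner_smul_right,
      inner_add_right, smul_eq_mul]
    ring
  have hexp : Real.exp (-2 * η * (Real.log (σ.1 ^ 2 - ‖σ.2‖ ^ 2) +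
        2 * Psi σ ((2:ℝ)⁻¹ • (x + y)) / (σ.1 ^ 2 - ‖σ.2‖ ^ 2))) =
      (σ.1 ^ 2 - ‖σ.2‖ ^ 2) ^ (-η) * (σ.1 ^ 2 - ‖σ.2‖ ^ 2) ^ (-η) *
      Real.exp (-2 * η * (σ.1 * x.1 - ⟪σ.2, x.2⟫) / (σ.1 ^ 2 - ‖σ.2‖ ^ 2)) *
      Real.exp (-2 * η * (σ.1 * y.1 - ⟪σ.2, y.2⟫) / (σ.1 ^ 2 - ‖σ.2‖ ^ 2)) := by
    rw [Real.rpow_def_of_pos hd, ← Real.exp_add, ← Real.exp_add, ← Real.exp_add, hPsi]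
    congr 1
    ring
  rw [hexp, wishartDensity, wishartDensity, if_pos hx, if_pos hy]
  ring

/-- On the Lorentz cone, `σ ↦ log Δ(σ) + 2 Ψ(σ, τ) / Δ(σ)` is minimal at `σ = τ`, where
`Δ(σ) = Ψ(σ, σ)`. -/
lemma LorentzCone.log_add_two_le {m : ℕ} {σ τ : ℝ × EuclideanSpace ℝ (Fin m)}
    (hσ : σ ∈ LorentzCone m) (hτ : τ ∈ LorentzCone m) :
    Real.log (τ.1 ^ 2 - ‖τ.2‖ ^ 2) + 2 ≤
      Real.log (σ.1 ^ 2 - ‖σ.2‖ ^ 2) + 2 * Psi σ τ / (σ.1 ^ 2 - ‖σ.2‖ ^ 2) := by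
  have hPsi := LorentzCone.sqrt_mul_sqrt_le_Psi hσ hτ
  have hd : 0 < σ.1 ^ 2 - ‖σ.2‖ ^ 2 := sub_pos.2 hσ.2
  have hD : 0 < τ.1 ^ 2 - ‖τ.2‖ ^ 2 := sub_pos.2 hτ.2
  set d := σ.1 ^ 2 - ‖σ.2‖ ^ 2
  set D := τ.1 ^ 2 - ‖τ.2‖ ^ 2
  have hd' : 0 < √d := Real.sqrt_pos.2 hd
  have hD' : 0 < √D := Real.sqrt_pos.2 hD
  have hlog := Real.log_le_sub_one_of_pos (div_pos hD' hd')
  rw [Real.log_div hD'.ne' hd'.ne', Real.log_sqrt hD.le, Real.log_sqrt hd.le] at hlog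
  have hratio : √D / √d ≤ Psi σ τ / d := by
    calc √D / √d = √d * √D / (√d * √d) := by field_simp
      _ = √d * √D / d := by rw [Real.mul_self_sqrt hd.le]
      _ ≤ Psi σ τ / d := by gcongr
  rw [mul_div_assoc]
  linarith

theorem mle_common_parameter (m : ℕ) (hm : 1 ≤ m) (η : ℝ) (hη : ((m : ℝ) - 1) / 2 < η)
    (τ₁ τ₂ : ℝ × EuclideanSpace ℝ (Fin m))
    (h₁ : τ₁ ∈ LorentzCone m) (h₂ : τ₂ ∈ LorentzCone m)
    (σ : ℝ × EuclideanSpace ℝ (Fin m)) (hσ : σ ∈ LorentzCone m) :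
    wishartDensity m η σ τ₁ * wishartDensity m η σ τ₂ ≤
      wishartDensity m η ((2:ℝ)⁻¹ • (τ₁ + τ₂)) τ₁ *
        wishartDensity m η ((2:ℝ)⁻¹ • (τ₁ + τ₂)) τ₂ := by
  have hη₀ : 0 < η := by
    have : (1 : ℝ) ≤ m := by exact_mod_cast hm
    linarith
  have hτ := LorentzCone.midpoint_mem h₁ h₂
  have hD : 0 < ((2:ℝ)⁻¹ • (τ₁ + τ₂)).1 ^ 2 - ‖((2:ℝ)⁻¹ • (τ₁ + τ₂)).2‖ ^ 2 := sub_pos.2 hτ.2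
  have hself : Psi ((2:ℝ)⁻¹ • (τ₁ + τ₂)) ((2:ℝ)⁻¹ • (τ₁ + τ₂)) =
      ((2:ℝ)⁻¹ • (τ₁ + τ₂)).1 ^ 2 - ‖((2:ℝ)⁻¹ • (τ₁ + τ₂)).2‖ ^ 2 := by
    rw [Psi, real_inner_self_eq_norm_sq]
    ring
  have hA₁ := Real.rpow_nonneg (sub_pos.2 h₁.2).le (η - ((m : ℝ) + 1) / 2)
  have hA₂ := Real.rpow_nonneg (sub_pos.2 h₂.2).le (η - ((m : ℝ) + 1) / 2)
  rw [wishartDensity_mul_wishartDensity η hσ h₁ h₂, wishartDensity_mul_wishartDensity η hτ h₁ h₂]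
  refine mul_le_mul_of_nonneg_left (Real.exp_le_exp.2 ?_) (by positivity)
  rw [hself, mul_div_cancel_right₀ _ hD.ne']
  exact mul_le_mul_of_nonpos_left (LorentzCone.log_add_two_le hσ hτ) (by linarith)
end
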